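/- Let A be a real m×n matrix, B a real m×p matrix, I≤ and I= disjoint sets of row indices with I≤ ∪ I= = {1,…,m}, and suppose the feasible region Ω = {X ∈ ℝ^{n×p} : (AX)_{ij} ≤ B_{ij} for all i ∈ I≤ and all j, and (AX)_{ij} = B_{ij} for all i ∈ I= and all j} is nonempty. Let τ ⊆ I= be a set of row indices with ‖A_τ‖_F > 0, let t ≥ 0, and set X⁺ = X − (t/‖A_τ‖_F²)·A_τᵀ(A_τX − B_τ) for a given X ∈ ℝ^{n×p}. Then d(X⁺, Ω)² ≤ d(X, Ω)² − (2t/‖A_τ‖_F²)·(1 − t/2)·‖A_τX − B_τ‖_F². -/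

import Mathlib

open Finset

/-- Frobenius norm of a real matrix. -/
noncomputable def frob {a b : ℕ} (M : Matrix (Fin a) (Fin b) ℝ) : ℝ :=
  Real.sqrt (∑ i, ∑ j, (M i j) ^ 2)

/-- Distance (w.r.t. Frobenius norm) of a matrix to a set of matrices. -/
noncomputable def mdist {a b : ℕ} (X : Matrix (Fin a) (Fin b) ℝ)
    (Ω : Set (Matrix (Fin a) (Fin b) ℝ)) : ℝ :=
  sInf ((fun Y => frob (X - Y)) '' Ω)

theorem frob_nonneg {a b : ℕ} (M : Matrix (Fin a) (Fin b) ℝ) : 0 ≤ frob M :=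
  Real.sqrt_nonneg _

theorem frob_sq {a b : ℕ} (M : Matrix (Fin a) (Fin b) ℝ) :
    frob M ^ 2 = ∑ i, ∑ j, (M i j) ^ 2 :=
  Real.sq_sqrt (by positivity)

theorem mdist_nonneg {a b : ℕ} (X : Matrix (Fin a) (Fin b) ℝ)
    (Ω : Set (Matrix (Fin a) (Fin b) ℝ)) : 0 ≤ mdist X Ω := by
  apply Real.sInf_nonneg
  rintro _ ⟨Y, -, rfl⟩
  exact frob_nonneg _

theorem mdist_le_frob {a b : ℕ} (X : Matrix (Fin a) (Fin b) ℝ)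
    {Ω : Set (Matrix (Fin a) (Fin b) ℝ)} {Y : Matrix (Fin a) (Fin b) ℝ} (hY : Y ∈ Ω) :
    mdist X Ω ≤ frob (X - Y) := by
  refine csInf_le ⟨0, ?_⟩ ⟨Y, hY, rfl⟩
  rintro _ ⟨Z, -, rfl⟩
  exact frob_nonneg _

/-- A lower bound on the squared distance to every point of a nonempty set is a lower bound on
the squared distance to the set. -/
theorem le_mdist_sq {a b : ℕ} (X : Matrix (Fin a) (Fin b) ℝ)
    {Ω : Set (Matrix (Fin a) (Fin b) ℝ)} (hne : Ω.Nonempty) {c : ℝ}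
    (h : ∀ Y ∈ Ω, c ≤ frob (X - Y) ^ 2) : c ≤ mdist X Ω ^ 2 := by
  have hle : Real.sqrt c ≤ mdist X Ω := by
    refine le_csInf (hne.image _) ?_
    rintro _ ⟨Y, hY, rfl⟩
    exact Real.sqrt_le_iff.2 ⟨frob_nonneg _, h Y hY⟩
  exact (Real.sqrt_le_iff.1 hle).2

/-- Submultiplicativity of the Frobenius norm for the product `A_τᵀ R_τ`. -/
theorem sum_sq_transpose_mul_le {ι κ μ : Type*} [Fintype κ] [Fintype μ] (τ : Finset ι)
    (A : ι → κ → ℝ) (R : ι → μ → ℝ) :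
    ∑ j, ∑ q, (∑ i ∈ τ, A i j * R i q) ^ 2 ≤
      (∑ i ∈ τ, ∑ j, A i j ^ 2) * ∑ i ∈ τ, ∑ q, R i q ^ 2 := by
  rw [Finset.sum_comm (s := τ), Finset.sum_comm (s := τ), Finset.sum_mul_sum]
  gcongr
  exact Finset.sum_mul_sq_le_sq_mul_sq _ _ _

/-- The pairing of `E` with `A_τᵀ R_τ` is the pairing of `A_τ E` with `R_τ`. -/
theorem sum_mul_transpose_mul {ι κ μ : Type*} [Fintype κ] [Fintype μ] (τ : Finset ι)
    (A : ι → κ → ℝ) (E : κ → μ → ℝ) (R : ι → μ → ℝ) :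
    ∑ j, ∑ q, E j q * ∑ i ∈ τ, A i j * R i q =
      ∑ i ∈ τ, ∑ q, (∑ j, A i j * E j q) * R i q := by
  simp only [Finset.mul_sum, Finset.sum_mul]
  calc _ = ∑ j, ∑ i ∈ τ, ∑ q, E j q * (A i j * R i q) :=
        Finset.sum_congr rfl fun j _ => Finset.sum_comm
    _ = ∑ i ∈ τ, ∑ j, ∑ q, E j q * (A i j * R i q) := Finset.sum_comm
    _ = _ := by
        refine Finset.sum_congr rfl fun i _ => ?_
        rw [Finset.sum_comm]
        exact Finset.sum_congr rfl fun q _ => Finset.sum_congr rfl fun j _ => by ring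

/-- One B-MRK step on a block of equality constraints decreases the squared
distance to the feasible region. -/
theorem bmrk_eq_step {m n p : ℕ}
    (A : Matrix (Fin m) (Fin n) ℝ) (B : Matrix (Fin m) (Fin p) ℝ)
    (Ile Ieq : Finset (Fin m)) (hdisj : Disjoint Ile Ieq)
    (hunion : Ile ∪ Ieq = Finset.univ)
    (Ω : Set (Matrix (Fin n) (Fin p) ℝ))
    (hΩ : Ω = {X | (∀ i ∈ Ile, ∀ j, (A * X) i j ≤ B i j) ∧
                   (∀ i ∈ Ieq, ∀ j, (A * X) i j = B i j)})
    (hne : Ω.Nonempty)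
    (τ : Finset (Fin m)) (hτ : τ ⊆ Ieq)
    (hAτ : 0 < ∑ i ∈ τ, ∑ j, (A i j) ^ 2)
    (t : ℝ) (ht : 0 ≤ t)
    (X Xp : Matrix (Fin n) (Fin p) ℝ)
    (hXp : ∀ j q, Xp j q =
      X j q - (t / ∑ i ∈ τ, ∑ j', (A i j') ^ 2) *
        ∑ i ∈ τ, A i j * ((A * X - B) i q)) :
    mdist Xp Ω ^ 2 ≤ mdist X Ω ^ 2 -
      (2 * t / ∑ i ∈ τ, ∑ j, (A i j) ^ 2) * (1 - t / 2) *
        ∑ i ∈ τ, ∑ q, ((A * X - B) i q) ^ 2 := by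
  rw [le_sub_iff_add_le]
  refine le_mdist_sq X hne fun Y hY => ?_
  have hstep := pow_le_pow_left₀ (mdist_nonneg Xp Ω) (mdist_le_frob Xp hY) 2
  refine (add_le_add_left hstep _).trans ?_
  set s := ∑ i ∈ τ, ∑ j, (A i j) ^ 2
  set r := ∑ i ∈ τ, ∑ q, ((A * X - B) i q) ^ 2
  have hres : ∀ i ∈ τ, ∀ q, ∑ j, A i j * (X - Y) j q = (A * X - B) i q := by
    intro i hi q
    rw [hΩ] at hY
    rw [Matrix.sub_apply, ← hY.2 i (hτ hi) q, ← Matrix.sub_apply, ← Matrix.mul_sub,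
      Matrix.mul_apply]
  have hcross : ∑ j, ∑ q, (X - Y) j q * ∑ i ∈ τ, A i j * (A * X - B) i q = r := by
    refine (sum_mul_transpose_mul τ A (X - Y) (A * X - B)).trans ?_
    refine Finset.sum_congr rfl fun i hi => Finset.sum_congr rfl fun q _ => ?_
    rw [hres i hi q, sq]
  have hquad : ∑ j, ∑ q, (∑ i ∈ τ, A i j * (A * X - B) i q) ^ 2 ≤ s * r :=
    sum_sq_transpose_mul_le τ A (A * X - B)
  have hexpand : frob (Xp - Y) ^ 2 = frob (X - Y) ^ 2 - 2 * (t / s) * r +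
      (t / s) ^ 2 * ∑ j, ∑ q, (∑ i ∈ τ, A i j * (A * X - B) i q) ^ 2 := by
    rw [frob_sq, frob_sq, ← hcross]
    simp only [Finset.mul_sum (s := Finset.univ), ← Finset.sum_sub_distrib,
      ← Finset.sum_add_distrib]
    refine Finset.sum_congr rfl fun j _ => Finset.sum_congr rfl fun q _ => ?_
    rw [Matrix.sub_apply, Matrix.sub_apply, hXp]
    ring
  have hbound := mul_le_mul_of_nonneg_left hquad (sq_nonneg (t / s))
  have hscale : (t / s) ^ 2 * (s * r) = t ^ 2 / s * r := by
    field_simp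
  rw [hexpand]
  calc _ ≤ frob (X - Y) ^ 2 - 2 * (t / s) * r + t ^ 2 / s * r +
        2 * t / s * (1 - t / 2) * r := by linarith
    _ = frob (X - Y) ^ 2 := by ring
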